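/- arXiv:2310.16558 — 4 statements merged into one kernel-verified Lean document; each statement's English description precedes it below -/
import Mathlib

section
/- Let R be a commutative ring, t ∈ R, and let I, J, K be ideals of R. Assume: (i) t is a nonzerodivisor on R/I; (ii) t is a nonzerodivisor on R/J; (iii) J ⊆ K + (t); (iv) I ∩ (K + (t)) ⊆ (t). Then t is a nonzerodivisor on R/(I + J), i.e., for every z ∈ R, t·z ∈ I + J implies z ∈ I + J. -/
/-- If `t` is a nonzerodivisor on `R/I` and on `R/J`, `J ⊆ K + (t)`, and
`I ∩ (K + (t)) ⊆ (t)`, then `t` is a nonzerodivisor on `R/(I + J)`. -/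
theorem stmt_0 {R : Type*} [CommRing R] (t : R) (I J K : Ideal R)
    (hI : ∀ z : R, t * z ∈ I → z ∈ I)
    (hJ : ∀ z : R, t * z ∈ J → z ∈ J)
    (hJK : J ≤ K + Ideal.span {t})
    (hIK : I ⊓ (K + Ideal.span {t}) ≤ Ideal.span {t}) :
    ∀ z : R, t * z ∈ I + J → z ∈ I + J := by
  intro z hz
  obtain ⟨a, ha, b, hb, hab⟩ := Submodule.mem_sup.mp hz
  have haK : a ∈ K + Ideal.span {t} := by
    rw [eq_sub_of_add_eq hab]
    exact sub_mem (Ideal.mem_sup_right (Ideal.mem_span_singleton.mpr (dvd_mul_right t z))) (hJK hb)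
  obtain ⟨c, rfl⟩ := Ideal.mem_span_singleton.mp (hIK ⟨ha, haK⟩)
  have hzc : z - c ∈ J := hJ _ (by rwa [mul_sub, ← hab, add_sub_cancel_left])
  exact Submodule.mem_sup.mpr ⟨c, hI c ha, z - c, hzc, add_sub_cancel c z⟩
end

section
/- Let R be a commutative ring, let I and J be ideals of R with I ∩ J = (0), let r ∈ I and t ∈ R. Assume: (i) t is a nonzerodivisor on R/I; (ii) t is a nonzerodivisor on R/(J + (r)). Then t is a nonzerodivisor on R/(r): for every z ∈ R, t·z ∈ (r) implies z ∈ (r). -/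
/-- With `I ∩ J = (0)`, `r ∈ I`, `t` a nonzerodivisor on `R/I` and on
`R/(J + (r))`, the element `t` is a nonzerodivisor on `R/(r)`. -/
theorem stmt_1 {R : Type*} [CommRing R] (I J : Ideal R) (hIJ : I ⊓ J = ⊥)
    (r t : R) (hr : r ∈ I)
    (hI : ∀ z : R, t * z ∈ I → z ∈ I)
    (hJr : ∀ z : R, t * z ∈ J + Ideal.span {r} → z ∈ J + Ideal.span {r}) :
    ∀ z : R, t * z ∈ Ideal.span {r} → z ∈ Ideal.span {r} := by
  intro z hz
  have hrI : Ideal.span {r} ≤ I := (Ideal.span_singleton_le_iff_mem I).2 hr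
  have hzI : z ∈ I := hI z (hrI hz)
  obtain ⟨j, hj, s, hs, rfl⟩ := Submodule.mem_sup.1 (hJr z (Ideal.mem_sup_right hz))
  have hjI : j ∈ I := (Ideal.add_mem_iff_left I (hrI hs)).1 hzI
  have hj0 : j ∈ I ⊓ J := ⟨hjI, hj⟩
  rw [hIJ, Ideal.mem_bot] at hj0
  rwa [hj0, zero_add]
end

section
/- Let R be a commutative ring, let I and J be ideals of R with I ∩ J = (0), let r ∈ I and t ∈ R. Assume: (i) t is a nonzerodivisor on R/I; (ii) t is a nonzerodivisor on R/(J + (r)); (iii) r is a nonzerodivisor on R/J. Then for every v ∈ R, r·v ∈ (t) implies v ∈ J + (t). -/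
/-- With `I ∩ J = (0)`, `r ∈ I`, `t` a nonzerodivisor on `R/I` and on
`R/(J + (r))`, and `r` a nonzerodivisor on `R/J`, every `v` with `r·v ∈ (t)` lies in `J + (t)`. -/
theorem stmt_2 {R : Type*} [CommRing R] (I J : Ideal R) (hIJ : I ⊓ J = ⊥)
    (r t : R) (hr : r ∈ I)
    (hI : ∀ z : R, t * z ∈ I → z ∈ I)
    (hJr : ∀ z : R, t * z ∈ J + Ideal.span {r} → z ∈ J + Ideal.span {r})
    (hrJ : ∀ z : R, r * z ∈ J → z ∈ J) :
    ∀ v : R, r * v ∈ Ideal.span {t} → v ∈ J + Ideal.span {t} := by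
  intro v hv
  obtain ⟨a, ha⟩ := Ideal.mem_span_singleton'.1 hv
  have hta : t * a ∈ J + Ideal.span {r} := by
    rw [mul_comm, ha]
    exact Ideal.mem_sup_right (Ideal.mul_mem_right v _ (Ideal.mem_span_singleton_self r))
  obtain ⟨j, hj, _, hc, rfl⟩ := Submodule.mem_sup.1 (hJr a hta)
  obtain ⟨c, rfl⟩ := Ideal.mem_span_singleton'.1 hc
  have hvc : v - c * t ∈ J := by
    apply hrJ
    have h : r * (v - c * t) = t * j := by linear_combination -ha
    exact h ▸ Ideal.mul_mem_left J t hj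
  exact Submodule.mem_sup.2
    ⟨v - c * t, hvc, c * t, Ideal.mem_span_singleton'.2 ⟨c, rfl⟩, sub_add_cancel _ _⟩
end

section
/- Let e, p, c be natural numbers with e ≤ p and e ≤ c. For every pair (K, L) consisting of an e-element subset K of {1,…,p} and an e-element subset L of {1,…,c}, let α_{K,L} be a complex number, and assume that not all α_{K,L} are zero. Then there exist an e × p complex matrix A and a c × e complex matrix B such that Σ_{K,L} α_{K,L} · det(A_K) · det(B_L) ≠ 0, where A_K is the e × e submatrix of A consisting of the columns indexed by K (in increasing order) and B_L is the e × e submatrix of B consisting of the rows indexed by L (in increasing order). -/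
/-- The `e × n` coordinate matrix of an `e`-element subset `K₀` has maximal minor `1` at `K₀` and
`0` at every other `e`-element subset. -/
theorem det_submatrix_one_orderEmbOfFin {R : Type*} [CommRing R] {e n : ℕ}
    (K₀ K : {s : Finset (Fin n) // s.card = e}) :
    ((1 : Matrix (Fin n) (Fin n) R).submatrix
      (K₀.1.orderEmbOfFin K₀.2) (K.1.orderEmbOfFin K.2)).det = if K = K₀ then 1 else 0 := by
  split_ifs with h
  · subst h
    rw [Matrix.submatrix_one _ (K.1.orderEmbOfFin K.2).injective, Matrix.det_one]
  · obtain ⟨k, hk₀, hk⟩ : ∃ k ∈ K₀.1, k ∉ K.1 := by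
      by_contra! hsub
      exact h (Subtype.ext (Finset.eq_of_subset_of_card_le hsub (by rw [K.2, K₀.2])).symm)
    obtain ⟨i, rfl⟩ : k ∈ Set.range (K₀.1.orderEmbOfFin K₀.2) := by
      rwa [Finset.range_orderEmbOfFin]
    refine Matrix.det_eq_zero_of_row_eq_zero i fun j => Matrix.one_apply_ne fun hij => hk ?_
    rw [hij]
    exact K.1.orderEmbOfFin_mem K.2 j

/-- If the complex numbers `α_{K,L}`, indexed by `e`-element subsets
`K ⊆ {1,…,p}` and `L ⊆ {1,…,c}`, are not all zero, then there exist matrices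
`A ∈ Mat(e×p, ℂ)` and `B ∈ Mat(c×e, ℂ)` with `Σ_{K,L} α_{K,L} · det(A_K) · det(B_L) ≠ 0`. -/
theorem stmt_7 (e p c : ℕ) (hep : e ≤ p) (hec : e ≤ c)
    (α : {s : Finset (Fin p) // s.card = e} → {s : Finset (Fin c) // s.card = e} → ℂ)
    (hα : ∃ K L, α K L ≠ 0) :
    ∃ (A : Matrix (Fin e) (Fin p) ℂ) (B : Matrix (Fin c) (Fin e) ℂ),
      (∑ K : {s : Finset (Fin p) // s.card = e}, ∑ L : {s : Finset (Fin c) // s.card = e},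
        α K L * (A.submatrix id (K.1.orderEmbOfFin K.2)).det *
          (B.submatrix (L.1.orderEmbOfFin L.2) id).det) ≠ 0 := by
  obtain ⟨K₀, L₀, h⟩ := hα
  refine ⟨(1 : Matrix (Fin p) (Fin p) ℂ).submatrix (K₀.1.orderEmbOfFin K₀.2) id,
    (1 : Matrix (Fin c) (Fin c) ℂ).submatrix id (L₀.1.orderEmbOfFin L₀.2), ?_⟩
  simpa [Matrix.submatrix_submatrix, det_submatrix_one_orderEmbOfFin, eq_comm] using h
end
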